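/- arXiv:0803.4261 — 2 statements merged into one kernel-verified Lean document; each statement's English description precedes it below -/
import Mathlib

section
/- Let U be a finite set of Boolean variables and C = {c₁,…,c_n} a collection of clauses over U with exactly three literals per clause. Let Σ consist of a boundary symbol •, symbols u^i and ū^i for every variable u ∈ U and every clause c_i containing u or ¬u, and three extra symbols α_i, β_i, γ_i for every clause c_i. Define strings a and b as in the original reduction (truth-setting variable blocks u^{i₁}⋯u^{i_m} ū^{i₁}⋯ū^{i_m} in a versus ū^{i₁}⋯ū^{i_m} u^{i₁}⋯u^{i_m} in b, followed by •), except that for each clause c_i = {x,y,z} the clause block of a is x̄^i x^i α_i β_i y^i ȳ^i α_i γ_i β_i z̄^i γ_i z^i and the clause block of b is x^i α_i x̄^i ȳ^i β_i y^i γ_i α_i β_i γ_i z^i z̄^i. Then there exists a permutation of Σ that is a common subsequence of a and b if and only if C is satisfiable. -/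
namespace CommonPerm

/-! ## The modified reduction from 3SAT to Common Permutation (Corollary 1) -/

/-- A literal over variables `Fin m`: a variable together with a sign
(`true` = positive literal `u`, `false` = negated literal `¬u`). -/
abbrev Lit (m : ℕ) := Fin m × Bool

/-- A 3-clause: an (ordered) triple of literals `(x, y, z)`. -/
abbrev Clause (m : ℕ) := Lit m × Lit m × Lit m

/-- The symbols of the alphabet `Σ` of the modified construction:
`none` is the boundary symbol `•`, `some (.inl (u, i, true))` (resp. `false`) is the
symbol `u^i` (resp. `ū^i`), and `some (.inr (i, 0/1/2))` are the extra symbols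
`α_i`, `β_i`, `γ_i` of the clause `c_i`. -/
abbrev Symb (m n : ℕ) := Option ((Fin m × Fin n × Bool) ⊕ (Fin n × Fin 3))

/-- The variable `u` occurs (positively or negatively) in clause `C i`. -/
abbrev OccursIn {m n : ℕ} (C : Fin n → Clause m) (u : Fin m) (i : Fin n) : Prop :=
  (C i).1.1 = u ∨ (C i).2.1.1 = u ∨ (C i).2.2.1 = u

/-- Membership in the alphabet `Σ`: the boundary symbol `•`, the symbols `u^i`, `ū^i`
for every variable `u` and every clause `c_i` in which `u` appears, and the symbols
`α_i`, `β_i`, `γ_i` for every clause `c_i`. -/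
def InSigma {m n : ℕ} (C : Fin n → Clause m) : Symb m n → Prop
  | none => True
  | some (.inl (u, i, _)) => OccursIn C u i
  | some (.inr _) => True

instance {m n : ℕ} (C : Fin n → Clause m) : DecidablePred (InSigma C) := fun s =>
  match s with
  | none => .isTrue trivial
  | some (.inl (_, _, _)) => inferInstanceAs (Decidable (_ ∨ _ ∨ _))
  | some (.inr _) => .isTrue trivial

/-- The indices `i₁ < ⋯ < i_m` of the clauses in which the variable `u` appears. -/
def clausesOf {m n : ℕ} (C : Fin n → Clause m) (u : Fin m) : List (Fin n) :=
  (List.finRange n).filter fun i => decide (OccursIn C u i)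

/-- The truth-setting block of the string `a` for the variable `u`:
`u^{i₁} ⋯ u^{i_m} ū^{i₁} ⋯ ū^{i_m}`. -/
def vblockA {m n : ℕ} (C : Fin n → Clause m) (u : Fin m) : List (Symb m n) :=
  ((clausesOf C u).map fun i => some (.inl (u, i, true))) ++
    ((clausesOf C u).map fun i => some (.inl (u, i, false)))

/-- The truth-setting block of the string `b` for the variable `u`:
`ū^{i₁} ⋯ ū^{i_m} u^{i₁} ⋯ u^{i_m}`. -/
def vblockB {m n : ℕ} (C : Fin n → Clause m) (u : Fin m) : List (Symb m n) :=
  ((clausesOf C u).map fun i => some (.inl (u, i, false))) ++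
    ((clausesOf C u).map fun i => some (.inl (u, i, true)))

/-- For a literal `x` of clause `c_i`, the symbol `x^i` (i.e. `u^i` if `x = u`
is positive, and `ū^i` if `x = ¬u`). -/
def litSym {m n : ℕ} (i : Fin n) (l : Lit m) : Symb m n := some (.inl (l.1, i, l.2))

/-- For a literal `x` of clause `c_i`, the symbol `x̄^i` (i.e. `ū^i` if `x = u`
is positive, and `u^i` if `x = ¬u`). -/
def litSymBar {m n : ℕ} (i : Fin n) (l : Lit m) : Symb m n := some (.inl (l.1, i, !l.2))

/-- The extra symbols of clause `c_i`: `extra i 0 = α_i`, `extra i 1 = β_i`,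
`extra i 2 = γ_i`. -/
def extra {m n : ℕ} (i : Fin n) (k : Fin 3) : Symb m n := some (.inr (i, k))

/-- The satisfaction-testing block of `a` for clause `c_i = {x, y, z}`:
`x̄^i x^i α_i β_i y^i ȳ^i α_i γ_i β_i z̄^i γ_i z^i`. -/
def cblockA {m n : ℕ} (C : Fin n → Clause m) (i : Fin n) : List (Symb m n) :=
  [litSymBar i (C i).1, litSym i (C i).1, extra i 0, extra i 1,
   litSym i (C i).2.1, litSymBar i (C i).2.1, extra i 0, extra i 2, extra i 1,
   litSymBar i (C i).2.2, extra i 2, litSym i (C i).2.2]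

/-- The satisfaction-testing block of `b` for clause `c_i = {x, y, z}`:
`x^i α_i x̄^i ȳ^i β_i y^i γ_i α_i β_i γ_i z^i z̄^i`. -/
def cblockB {m n : ℕ} (C : Fin n → Clause m) (i : Fin n) : List (Symb m n) :=
  [litSym i (C i).1, extra i 0, litSymBar i (C i).1,
   litSymBar i (C i).2.1, extra i 1, litSym i (C i).2.1,
   extra i 2, extra i 0, extra i 1, extra i 2,
   litSym i (C i).2.2, litSymBar i (C i).2.2]

/-- The string `a` of the modified reduction. -/
def strA {m n : ℕ} (C : Fin n → Clause m) : List (Symb m n) :=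
  ((List.finRange m).map (vblockA C)).flatten ++ [none] ++
    ((List.finRange n).map (cblockA C)).flatten

/-- The string `b` of the modified reduction. -/
def strB {m n : ℕ} (C : Fin n → Clause m) : List (Symb m n) :=
  ((List.finRange m).map (vblockB C)).flatten ++ [none] ++
    ((List.finRange n).map (cblockB C)).flatten

/-- The three literals of each clause involve three pairwise distinct variables
(`c_i` is a set of exactly three literals). -/
def ThreeDistinct {m n : ℕ} (C : Fin n → Clause m) : Prop :=
  ∀ i, (C i).1.1 ≠ (C i).2.1.1 ∧ (C i).1.1 ≠ (C i).2.2.1 ∧ (C i).2.1.1 ≠ (C i).2.2.1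

/-- The literal `l` is true under the truth assignment `t`. -/
def LitTrue {m : ℕ} (t : Fin m → Bool) (l : Lit m) : Prop := t l.1 = l.2

/-- The truth assignment `t` satisfies every clause of `C`. -/
def Satisfies {m n : ℕ} (t : Fin m → Bool) (C : Fin n → Clause m) : Prop :=
  ∀ i, LitTrue t (C i).1 ∨ LitTrue t (C i).2.1 ∨ LitTrue t (C i).2.2

/-- `p` is a permutation of the alphabet `Σ`: a string containing every symbol of `Σ`
exactly once. -/
def IsPermOfSigma {m n : ℕ} (C : Fin n → Clause m) (p : List (Symb m n)) : Prop :=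
  p.Nodup ∧ ∀ s, s ∈ p ↔ InSigma C s

/-- The nine symbols of clause `c_i`, enumerated as `x, x̄, y, ȳ, z, z̄, α, β, γ`. -/
def clauseSym {m n : ℕ} (C : Fin n → Clause m) (i : Fin n) : Fin 9 → Symb m n :=
  ![litSym i (C i).1, litSymBar i (C i).1, litSym i (C i).2.1, litSymBar i (C i).2.1,
    litSym i (C i).2.2, litSymBar i (C i).2.2, extra i 0, extra i 1, extra i 2]

/-- The clause block of `a` in terms of the enumeration `clauseSym`. -/
def patternA : List (Fin 9) := [1, 0, 6, 7, 2, 3, 6, 8, 7, 5, 8, 4]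

/-- The clause block of `b` in terms of the enumeration `clauseSym`. -/
def patternB : List (Fin 9) := [0, 6, 1, 3, 7, 2, 8, 6, 7, 8, 4, 5]

theorem cblockA_eq {m n : ℕ} (C : Fin n → Clause m) (i : Fin n) :
    cblockA C i = patternA.map (clauseSym C i) := rfl

theorem cblockB_eq {m n : ℕ} (C : Fin n → Clause m) (i : Fin n) :
    cblockB C i = patternB.map (clauseSym C i) := rfl

theorem clauseSym_injective {m n : ℕ} {C : Fin n → Clause m} (hC : ThreeDistinct C)
    (i : Fin n) : Function.Injective (clauseSym C i) := by
  obtain ⟨h₁, h₂, h₃⟩ := hC i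
  intro k l h
  fin_cases k <;> fin_cases l <;>
    simp_all [clauseSym, litSym, litSymBar, extra, Ne.symm h₁, Ne.symm h₂, Ne.symm h₃]

theorem exists_pattern_of_or (a b c : Bool) (h : a || b || c) :
    ∃ q : List (Fin 9), q.Sublist patternA ∧ q.Sublist patternB ∧ q.Nodup ∧
      ∀ k, k ∈ q ↔ k ∈ [if a then 0 else 1, if b then 2 else 3, if c then 4 else 5,
        (6 : Fin 9), 7, 8] := by
  cases a <;> cases b <;> cases c
  · simp at h
  · exact ⟨[1, 3, 6, 7, 8, 4], by decide⟩
  · exact ⟨[1, 7, 2, 6, 8, 5], by decide⟩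
  · exact ⟨[1, 7, 2, 6, 8, 4], by decide⟩
  · exact ⟨[0, 6, 3, 8, 7, 5], by decide⟩
  · exact ⟨[0, 6, 3, 7, 8, 4], by decide⟩
  · exact ⟨[0, 6, 7, 2, 8, 5], by decide⟩
  · exact ⟨[0, 6, 7, 2, 8, 4], by decide⟩

set_option maxRecDepth 100000 in
theorem no_pattern_with_negations_aux :
    ∀ q ∈ ([1, 6, 7, 3, 6, 8, 7, 5, 8] : List (Fin 9)).sublists',
      q.Sublist [6, 1, 3, 7, 8, 6, 7, 8, 5] → q.Nodup →
      ¬ (1 ∈ q ∧ 3 ∈ q ∧ 5 ∈ q ∧ 6 ∈ q ∧ 7 ∈ q ∧ 8 ∈ q) := by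
  decide +kernel

/-- No common subsequence of the two clause blocks contains `α, β, γ` once each together
with `x̄, ȳ, z̄`. -/
theorem no_pattern_with_negations {q : List (Fin 9)} (hA : q.Sublist patternA)
    (hB : q.Sublist patternB) (hq : q.Nodup) :
    ¬ (1 ∈ q ∧ 3 ∈ q ∧ 5 ∈ q ∧ 6 ∈ q ∧ 7 ∈ q ∧ 8 ∈ q) := by
  have := no_pattern_with_negations_aux
    (q.filter fun k => decide (k ≠ 0 ∧ k ≠ 2 ∧ k ≠ 4))
    (List.mem_sublists'.2 (hA.filter _)) (hB.filter _) (hq.filter _)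
  simpa [List.mem_filter] using this

theorem sublist_of_append_cons_sublist {α : Type*} {a : α} {p₁ p₂ l₁ l₂ : List α}
    (h : (p₁ ++ a :: p₂).Sublist (l₁ ++ a :: l₂)) (h₁ : a ∉ l₁) (h₂ : a ∉ l₂) :
    p₁.Sublist l₁ ∧ p₂.Sublist l₂ := by
  obtain ⟨r₁, r₂, hr, hr₁, hr₂⟩ := List.sublist_append_iff.1 h
  have har₁ : a ∉ r₁ := fun ha => h₁ (hr₁.subset ha)
  rcases List.append_eq_append_iff.1 hr with ⟨s, rfl, hs⟩ | ⟨s, rfl, rfl⟩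
  · cases s with
    | nil =>
      simp only [List.nil_append] at hs
      subst hs
      exact ⟨by simpa using hr₁, List.cons_sublist_cons.1 hr₂⟩
    | cons b s =>
      simp only [List.cons_append, List.cons.injEq] at hs
      simp [hs.1] at har₁
  · cases s with
    | nil => exact ⟨by simpa using hr₁, List.cons_sublist_cons.1 hr₂⟩
    | cons b s =>
      exfalso
      have : (s ++ a :: p₂).Sublist l₂ := by
        rw [List.cons_append] at hr₂
        exact hr₂.of_cons_cons
      exact h₂ (this.subset (by simp))

theorem filter_flatten_map {ι α : Type*} (g : ι → List α) (P : α → Bool)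
    (i : ι) (hi : ∀ s ∈ g i, P s) (hj : ∀ j, j ≠ i → ∀ s ∈ g j, ¬ P s) :
    ∀ {l : List ι}, l.Nodup → i ∈ l → (l.map g).flatten.filter P = g i := by
  intro l hl hil
  obtain ⟨l₁, l₂, rfl⟩ := List.append_of_mem hil
  have h₁ : ∀ j ∈ l₁, j ≠ i := by rintro j hj rfl; simp [List.nodup_append] at hl; grind
  have h₂ : ∀ j ∈ l₂, j ≠ i := by rintro j hj rfl; simp [List.nodup_append] at hl; grind
  have e : ∀ l : List ι, (∀ j ∈ l, j ≠ i) → (l.map g).flatten.filter P = [] := by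
    intro l h
    rw [List.filter_eq_nil_iff]
    intro s hs
    simp only [List.mem_flatten, List.mem_map] at hs
    obtain ⟨_, ⟨j, hjl, rfl⟩, hs⟩ := hs
    exact hj j (h j hjl) s hs
  rw [List.map_append, List.map_cons, List.flatten_append, List.flatten_cons,
    List.filter_append, List.filter_append, e _ h₁, e _ h₂, List.filter_eq_self.2 hi]
  simp

/-- The symbol belongs to clause `c_i`. -/
def ofClause {m n : ℕ} (i : Fin n) : Symb m n → Bool
  | none => false
  | some (.inl (_, j, _)) => j = i
  | some (.inr (j, _)) => j = i

theorem ofClause_clauseSym {m n : ℕ} (C : Fin n → Clause m) (i j : Fin n) (k : Fin 9) :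
    ofClause i (clauseSym C j k) = decide (j = i) := by
  fin_cases k <;> rfl

theorem filter_clauseBlocks {m n : ℕ} (C : Fin n → Clause m) (i : Fin n)
    (L : List (Fin 9)) :
    (((List.finRange n).map fun j => L.map (clauseSym C j)).flatten.filter (ofClause i)) =
      L.map (clauseSym C i) := by
  apply filter_flatten_map (fun j => L.map (clauseSym C j)) (ofClause i) i
  · simp [ofClause_clauseSym]
  · intro j hj
    simp [ofClause_clauseSym, hj]
  · exact List.nodup_finRange n
  · exact List.mem_finRange i

/-- Truth-setting symbols of the same variable with opposite signs do not occur in the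
order (sign `!b`, sign `b`). -/
def SignOrder {m n : ℕ} (b : Bool) (s s' : Symb m n) : Prop :=
  ∀ u i j, s = some (.inl (u, i, !b)) → s' ≠ some (.inl (u, j, b))

theorem pairwise_signOrder_blocks {m n : ℕ} (C : Fin n → Clause m) (b : Bool) :
    (((List.finRange m).map fun u =>
      ((clausesOf C u).map fun i => (some (.inl (u, i, b)) : Symb m n)) ++
        ((clausesOf C u).map fun i => some (.inl (u, i, !b)))).flatten).Pairwise
      (SignOrder b) := by
  rw [List.pairwise_flatten]
  constructor
  · intro l hl
    obtain ⟨u, -, rfl⟩ := List.mem_map.1 hl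
    simp only [List.pairwise_append, List.pairwise_map, List.mem_map]
    refine ⟨?_, ?_, ?_⟩
    · exact List.pairwise_of_forall fun _ _ => by simp [SignOrder]
    · exact List.pairwise_of_forall fun _ _ => by simp [SignOrder]
    · rintro _ ⟨i, -, rfl⟩ _ ⟨j, -, rfl⟩
      simp [SignOrder]
  · rw [List.pairwise_map]
    refine (List.nodup_finRange m).imp ?_
    intro u v huv s hs s' hs' w i j h h'
    subst h h'
    simp at hs hs'
    grind

theorem pair_sublist_or {α : Type*} {l : List α} {a b : α} (ha : a ∈ l) (hb : b ∈ l)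
    (hab : a ≠ b) : [a, b].Sublist l ∨ [b, a].Sublist l := by
  obtain ⟨l₁, l₂, rfl⟩ := List.append_of_mem ha
  rcases List.mem_append.1 hb with hb | hb
  · right
    exact (List.singleton_sublist.2 hb).append (List.singleton_sublist.2 (by simp))
  · left
    rcases List.mem_cons.1 hb with hb | hb
    · exact absurd hb.symm hab
    · exact ((List.singleton_sublist.2 hb).cons_cons a).trans (List.sublist_append_right _ _)

theorem none_notMem_vblocks {m n : ℕ} (C : Fin n → Clause m) :
    (none : Symb m n) ∉ ((List.finRange m).map (vblockA C)).flatten ∧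
      (none : Symb m n) ∉ ((List.finRange m).map (vblockB C)).flatten := by
  simp [vblockA, vblockB]

theorem none_notMem_cblocks {m n : ℕ} (C : Fin n → Clause m) :
    (none : Symb m n) ∉ ((List.finRange n).map (cblockA C)).flatten ∧
      (none : Symb m n) ∉ ((List.finRange n).map (cblockB C)).flatten := by
  simp [cblockA, cblockB, litSym, litSymBar, extra]

theorem satisfiable_of_commonPermutation {m n : ℕ} {C : Fin n → Clause m}
    (hC : ThreeDistinct C) {p : List (Symb m n)} (hp : IsPermOfSigma C p)
    (hA : p.Sublist (strA C)) (hB : p.Sublist (strB C)) :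
    ∃ t : Fin m → Bool, Satisfies t C := by
  obtain ⟨p₁, p₂, rfl⟩ := List.append_of_mem ((hp.2 none).2 trivial)
  simp only [strA, strB, List.append_assoc, List.singleton_append] at hA hB
  obtain ⟨hA₁, hA₂⟩ := sublist_of_append_cons_sublist hA (none_notMem_vblocks C).1
    (none_notMem_cblocks C).1
  obtain ⟨hB₁, hB₂⟩ := sublist_of_append_cons_sublist hB (none_notMem_vblocks C).2
    (none_notMem_cblocks C).2
  have key : ∀ u i j, some (.inl (u, i, true)) ∈ p₁ → some (.inl (u, j, false)) ∈ p₁ →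
      False := by
    intro u i j hi hj
    rcases pair_sublist_or hi hj (by simp) with h | h
    · have := (pairwise_signOrder_blocks C false).sublist (h.trans hB₁)
      exact List.rel_of_pairwise_cons this (List.mem_singleton_self _) u i j rfl rfl
    · have := (pairwise_signOrder_blocks C true).sublist (h.trans hA₁)
      exact List.rel_of_pairwise_cons this (List.mem_singleton_self _) u j i rfl rfl
  classical
  refine ⟨fun u => decide (∃ i, some (.inl (u, i, false)) ∈ p₁), fun i => ?_⟩
  have lit : ∀ l : Lit m, OccursIn C l.1 i → litSymBar i l ∉ p₂ →
      LitTrue (fun u => decide (∃ i, some (.inl (u, i, false)) ∈ p₁)) l := by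
    rintro ⟨u, b⟩ ho hl
    have hmem := (hp.2 (litSymBar i (u, b))).2 ho
    have hmem : litSymBar i (u, b) ∈ p₁ := by
      rcases List.mem_append.1 hmem with h | h
      · exact h
      · exact absurd (List.mem_of_ne_of_mem (by simp [litSymBar]) h) hl
    cases b
    · simp only [LitTrue, decide_eq_false_iff_not]
      rintro ⟨j, hj⟩
      exact key u i j hmem hj
    · simp only [LitTrue, decide_eq_true_eq]
      exact ⟨i, hmem⟩
  by_contra hcon
  have hx : litSymBar i (C i).1 ∈ p₂ := by
    by_contra h
    exact hcon (.inl (lit _ (.inl rfl) h))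
  have hy : litSymBar i (C i).2.1 ∈ p₂ := by
    by_contra h
    exact hcon (.inr (.inl (lit _ (.inr (.inl rfl)) h)))
  have hz : litSymBar i (C i).2.2 ∈ p₂ := by
    by_contra h
    exact hcon (.inr (.inr (lit _ (.inr (.inr rfl)) h)))
  have he : ∀ k, extra i k ∈ p₂ := by
    intro k
    have hmem := (hp.2 (extra i k)).2 trivial
    have hne : (extra i k : Symb m n) ∉ p₁ := by
      intro h
      have := hA₁.subset h
      simp [vblockA, extra] at this
    rcases List.mem_append.1 hmem with h | h
    · exact absurd h hne
    · exact List.mem_of_ne_of_mem (by simp [extra]) h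
  have hfA := hA₂.filter (ofClause i)
  have hfB := hB₂.filter (ofClause i)
  have eA := filter_clauseBlocks C i patternA
  have eB := filter_clauseBlocks C i patternB
  simp only [← cblockA_eq, ← cblockB_eq] at eA eB
  rw [eA, cblockA_eq] at hfA
  rw [eB, cblockB_eq] at hfB
  obtain ⟨q, hqA, hq⟩ := List.sublist_map_iff.1 hfA
  have hinj := clauseSym_injective hC i
  rw [hq] at hfB
  have hqB : q.Sublist patternB := by
    obtain ⟨r, hr, hqr⟩ := List.sublist_map_iff.1 hfB
    rwa [List.map_injective_iff.2 hinj hqr]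
  have hqn : q.Nodup := by
    have : (p₂.filter (ofClause i)).Nodup :=
      (hp.1.sublist ((List.sublist_cons_self _ _).trans (List.sublist_append_right _ _))).filter _
    rw [hq] at this
    exact this.of_map
  have mem : ∀ k, clauseSym C i k ∈ p₂ → k ∈ q := by
    intro k hk
    have : clauseSym C i k ∈ p₂.filter (ofClause i) := by
      simp [hk, ofClause_clauseSym]
    rwa [hq, List.mem_map_of_injective hinj] at this
  exact no_pattern_with_negations hqA hqB hqn
    ⟨mem 1 hx, mem 3 hy, mem 5 hz, mem 6 (he 0), mem 7 (he 1), mem 8 (he 2)⟩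

theorem exists_clauseBlock {m n : ℕ} {C : Fin n → Clause m} (hC : ThreeDistinct C)
    {t : Fin m → Bool} (ht : Satisfies t C) (i : Fin n) :
    ∃ q : List (Symb m n), q.Sublist (cblockA C i) ∧ q.Sublist (cblockB C i) ∧ q.Nodup ∧
      ∀ s, s ∈ q ↔ (∃ u, OccursIn C u i ∧ s = some (.inl (u, i, t u))) ∨
        ∃ k, s = extra i k := by
  obtain ⟨q, hqA, hqB, hqn, hq⟩ := exists_pattern_of_or (t (C i).1.1 == (C i).1.2)
    (t (C i).2.1.1 == (C i).2.1.2) (t (C i).2.2.1 == (C i).2.2.2) (by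
      have := ht i
      simpa [LitTrue, or_assoc] using this)
  refine ⟨q.map (clauseSym C i), hqA.map _, hqB.map _, hqn.map (clauseSym_injective hC i), ?_⟩
  have hpos : ∀ (l : Lit m) (k k' : Fin 9), clauseSym C i k = litSym i l →
      clauseSym C i k' = litSymBar i l →
      clauseSym C i (if t l.1 == l.2 then k else k') = some (.inl (l.1, i, t l.1)) := by
    rintro ⟨u, b⟩ k k' hk hk'
    cases b <;> cases h : t u <;> simp [hk, hk', litSym, litSymBar]
  intro s
  simp only [List.mem_map, hq, List.mem_cons, List.not_mem_nil, or_false, or_and_right,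
    exists_or, exists_eq_left, hpos (C i).1 0 1 rfl rfl, hpos (C i).2.1 2 3 rfl rfl,
    hpos (C i).2.2 4 5 rfl rfl, OccursIn, exists_eq_left', Fin.exists_fin_succ]
  simp [clauseSym, or_assoc, eq_comm]

theorem commonPermutation_of_satisfies {m n : ℕ} {C : Fin n → Clause m}
    (hC : ThreeDistinct C) {t : Fin m → Bool} (ht : Satisfies t C) :
    ∃ p : List (Symb m n), IsPermOfSigma C p ∧ p.Sublist (strA C) ∧ p.Sublist (strB C) := by
  choose q hqA hqB hqn hq using exists_clauseBlock hC ht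
  let v : Fin m → List (Symb m n) := fun u =>
    (clausesOf C u).map fun i => some (.inl (u, i, !t u))
  have hvA : ∀ u, (v u).Sublist (vblockA C u) := by
    intro u
    cases h : t u <;> simp [v, vblockA, h]
  have hvB : ∀ u, (v u).Sublist (vblockB C u) := by
    intro u
    cases h : t u <;> simp [v, vblockB, h]
  have flat : ∀ {k : ℕ} {f g : Fin k → List (Symb m n)}, (∀ u, (f u).Sublist (g u)) →
      ((List.finRange k).map f).flatten.Sublist ((List.finRange k).map g).flatten := by
    intro k f g h
    induction List.finRange k with
    | nil => simp
    | cons a l ih => simpa using (h a).append ih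
  have hv : ∀ s, s ∈ ((List.finRange m).map v).flatten ↔
      ∃ u i, OccursIn C u i ∧ s = some (.inl (u, i, !t u)) := by
    intro s
    simp only [v, clausesOf, List.mem_flatten, List.mem_map, List.mem_finRange, true_and,
      List.mem_filter, decide_eq_true_eq, exists_exists_eq_and]
    exact exists_congr fun u => exists_congr fun i => and_congr_right fun _ => eq_comm
  have hc : ∀ s, s ∈ ((List.finRange n).map q).flatten ↔
      ∃ i, (∃ u, OccursIn C u i ∧ s = some (.inl (u, i, t u))) ∨ ∃ k, s = extra i k := by
    intro s
    simp [hq]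
  have hvn : ((List.finRange m).map v).flatten.Nodup := by
    rw [List.nodup_flatten]
    constructor
    · intro l hl
      obtain ⟨u, -, rfl⟩ := List.mem_map.1 hl
      exact ((List.nodup_finRange n).filter _).map fun i j h => by simpa using h
    · rw [List.pairwise_map]
      refine (List.nodup_finRange m).imp ?_
      intro u w huw s hs hs'
      simp only [v, List.mem_map] at hs hs'
      grind
  have hcn : ((List.finRange n).map q).flatten.Nodup := by
    rw [List.nodup_flatten]
    constructor
    · intro l hl
      obtain ⟨i, -, rfl⟩ := List.mem_map.1 hl
      exact hqn i
    · rw [List.pairwise_map]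
      refine (List.nodup_finRange n).imp ?_
      intro i j hij s hs hs'
      rw [hq] at hs hs'
      simp only [extra] at hs hs'
      grind
  refine ⟨((List.finRange m).map v).flatten ++ [none] ++ ((List.finRange n).map q).flatten,
    ⟨?_, ?_⟩, ((flat hvA).append (.refl _)).append (flat hqA),
    ((flat hvB).append (.refl _)).append (flat hqB)⟩
  · simp only [List.append_assoc, List.singleton_append]
    rw [List.nodup_append, List.nodup_cons]
    refine ⟨hvn, ⟨?_, hcn⟩, ?_⟩
    · rw [hc]
      simp [extra]
    · intro s hs s' hs' h
      subst h
      rw [List.mem_cons, hc] at hs'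
      obtain ⟨u, i, -, rfl⟩ := (hv s).1 hs
      rcases hs' with h | ⟨j, ⟨w, -, h⟩ | ⟨k, h⟩⟩
      · cases h
      · simp only [Option.some.injEq, Sum.inl.injEq, Prod.mk.injEq] at h
        obtain ⟨rfl, -, h⟩ := h
        simp at h
      · simp [extra] at h
  · intro s
    rw [List.mem_append, List.mem_append, hv, hc]
    rcases s with _ | ⟨u, i, b⟩ | ⟨i, k⟩
    · simp [InSigma]
    · simp only [InSigma, extra, List.mem_singleton, reduceCtorEq, or_false, exists_false,
        Option.some.injEq, Sum.inl.injEq, Prod.mk.injEq]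
      constructor
      · rintro (⟨u', i', h, rfl, rfl, -⟩ | ⟨i', u', h, rfl, rfl, -⟩) <;> exact h
      · intro h
        by_cases hb : b = t u
        · exact .inr ⟨i, u, h, rfl, rfl, hb⟩
        · exact .inl ⟨u, i, h, rfl, rfl, by cases b <;> cases h : t u <;> simp_all⟩
    · simp [InSigma, extra]

/-- Corollary 1 of the paper, correctness of the modified reduction.
For the modified construction (with the extra symbols `α_i, β_i, γ_i` and the modified
clause blocks), there exists a permutation of the alphabet `Σ` that is a common
subsequence of the constructed strings `a` and `b` if and only if the 3SAT instance `C`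
(with exactly three literals, on pairwise distinct variables, per clause) is
satisfiable. -/
theorem modified_common_permutation_iff_satisfiable (m n : ℕ) (C : Fin n → Clause m)
    (hC : ThreeDistinct C) :
    (∃ p : List (Symb m n),
      IsPermOfSigma C p ∧ p.Sublist (strA C) ∧ p.Sublist (strB C)) ↔
    (∃ t : Fin m → Bool, Satisfies t C) := by
  constructor
  · rintro ⟨p, hp, hA, hB⟩
    exact satisfiable_of_commonPermutation hC hp hA hB
  · rintro ⟨t, ht⟩
    exact commonPermutation_of_satisfies hC ht

end CommonPerm
end

section
/- In the modified reduction construction of the Corollary (truth-setting variable blocks u^{i₁}⋯u^{i_m} ū^{i₁}⋯ū^{i_m} in a versus ū^{i₁}⋯ū^{i_m} u^{i₁}⋯u^{i_m} in b, boundary symbol •, and for each clause c_i = {x,y,z} the clause block x̄^i x^i α_i β_i y^i ȳ^i α_i γ_i β_i z̄^i γ_i z^i in a and x^i α_i x̄^i ȳ^i β_i y^i γ_i α_i β_i γ_i z^i z̄^i in b), each of the two constructed strings a and b contains every symbol of Σ exactly twice, with the exception of the boundary symbol •, which each string contains exactly once. In particular, every symbol occurs at most twice in each of a and b. -/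
namespace CommonPerm

instance instLawfulBEqSum {α β : Type*} [BEq α] [BEq β] [LawfulBEq α] [LawfulBEq β] :
    LawfulBEq (α ⊕ β) where
  rfl {a} := by
    rcases a with a | a
    · exact beq_self_eq_true a
    · exact beq_self_eq_true a
  eq_of_beq {a b} h := by
    rcases a with a | a <;> rcases b with b | b
    · exact congrArg Sum.inl (eq_of_beq (a := a) (b := b) h)
    · cases h
    · cases h
    · exact congrArg Sum.inr (eq_of_beq (a := a) (b := b) h)

theorem count_flatten_map_finRange {α : Type*} [BEq α] {k : ℕ} (f : Fin k → List α) (s : α) :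
    ((List.finRange k).map f).flatten.count s = ∑ j, (f j).count s := by
  rw [List.count_flatten, List.map_map, Fin.sum_univ_def]
  rfl

theorem perm_flatten_map {α β : Type*} {f g : α → List β} (h : ∀ j, (f j).Perm (g j))
    (l : List α) : ((l.map f).flatten).Perm (l.map g).flatten := by
  induction l with
  | nil => simp
  | cons x l ih => simpa using (h x).append ih

theorem vblockB_perm_vblockA {m n : ℕ} (C : Fin n → Clause m) (u : Fin m) :
    (vblockB C u).Perm (vblockA C u) :=
  List.perm_append_comm

theorem cblockB_perm_cblockA {m n : ℕ} (C : Fin n → Clause m) (i : Fin n) :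
    (cblockB C i).Perm (cblockA C i) := by
  rw [List.perm_iff_count]
  intro s
  simp only [cblockA, cblockB, List.count_cons, List.count_nil]
  omega

theorem strB_perm_strA {m n : ℕ} (C : Fin n → Clause m) : (strB C).Perm (strA C) :=
  ((perm_flatten_map (vblockB_perm_vblockA C) _).append_right _).append
    (perm_flatten_map (cblockB_perm_cblockA C) _)

theorem count_clausesOf {m n : ℕ} (C : Fin n → Clause m) (u : Fin m) (i : Fin n) :
    (clausesOf C u).count i = if OccursIn C u i then 1 else 0 := by
  have hnodup : (clausesOf C u).Nodup := (List.nodup_finRange n).filter _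
  rw [hnodup.count]
  simp [clausesOf]

theorem count_strA {m n : ℕ} (C : Fin n → Clause m) (s : Symb m n) :
    (strA C).count s = ∑ u, (vblockA C u).count s + [none].count s +
      ∑ i, (cblockA C i).count s := by
  simp only [strA, List.count_append, count_flatten_map_finRange]

theorem count_vblockA_inl {m n : ℕ} (C : Fin n → Clause m) (u v : Fin m) (i : Fin n)
    (b : Bool) :
    (vblockA C v).count (some (.inl (u, i, b))) =
      if v = u then (if OccursIn C u i then 1 else 0) else 0 := by
  have hmap (c : Bool) : ((clausesOf C v).map
      fun i => (some (.inl (v, i, c)) : Symb m n)).count (some (.inl (u, i, b))) =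
      if v = u ∧ c = b then (if OccursIn C u i then 1 else 0) else 0 := by
    by_cases h : v = u ∧ c = b
    · obtain ⟨rfl, rfl⟩ := h
      rw [if_pos ⟨rfl, rfl⟩, List.count_map_of_injective _ (fun i => (some (.inl (v, i, c)) : Symb m n))
        (fun x y hxy => by simpa using hxy), count_clausesOf]
    · rw [if_neg h, List.count_eq_zero]
      simp only [List.mem_map, not_exists, Option.some.injEq, Sum.inl.injEq, Prod.mk.injEq]
      tauto
  rw [vblockA, List.count_append, hmap, hmap]
  cases b <;> simp

theorem count_vblockA_inr {m n : ℕ} (C : Fin n → Clause m) (v : Fin m) (e : Fin n × Fin 3) :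
    (vblockA C v).count (some (.inr e)) = 0 := by
  simp [vblockA, List.count_eq_zero]

theorem count_vblockA_none {m n : ℕ} (C : Fin n → Clause m) (v : Fin m) :
    (vblockA C v).count none = 0 := by
  simp [vblockA, List.count_eq_zero]

theorem cblockA_perm {m n : ℕ} (C : Fin n → Clause m) (i : Fin n) :
    (cblockA C i).Perm ([litSym i (C i).1, litSymBar i (C i).1] ++
      [litSym i (C i).2.1, litSymBar i (C i).2.1] ++
      [litSym i (C i).2.2, litSymBar i (C i).2.2] ++
      [extra i 0, extra i 0, extra i 1, extra i 1, extra i 2, extra i 2]) := by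
  rw [List.perm_iff_count]
  intro s
  simp only [cblockA, List.count_append, List.count_cons, List.count_nil]
  omega

theorem count_litSym_pair {m n : ℕ} (l : Lit m) (u : Fin m) (i j : Fin n) (b : Bool) :
    [litSym j l, litSymBar j l].count (some (.inl (u, i, b))) =
      if j = i ∧ l.1 = u then 1 else 0 := by
  obtain ⟨v, c⟩ := l
  by_cases hj : j = i <;> by_cases hv : v = u <;> cases b <;> cases c <;>
    simp [litSym, litSymBar, hj, hv]

theorem count_cblockA_inl {m n : ℕ} {C : Fin n → Clause m} (hC : ThreeDistinct C)
    (u : Fin m) (i j : Fin n) (b : Bool) :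
    (cblockA C j).count (some (.inl (u, i, b))) =
      if j = i then (if OccursIn C u i then 1 else 0) else 0 := by
  have hextra : [extra j 0, extra j 0, extra j 1, extra j 1, extra j 2, extra j 2].count
      (some (.inl (u, i, b)) : Symb m n) = 0 := by
    simp [extra]
  rw [(cblockA_perm C j).count_eq]
  simp only [List.count_append, count_litSym_pair, hextra]
  by_cases h : j = i
  · subst h
    have := hC j
    unfold OccursIn
    grind
  · simp [h]

theorem count_cblockA_inr {m n : ℕ} (C : Fin n → Clause m) (i j : Fin n) (k : Fin 3) :
    (cblockA C j).count (some (.inr (i, k))) = if j = i then 2 else 0 := by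
  by_cases h : j = i
  · fin_cases k <;> simp [cblockA, litSym, litSymBar, extra, h]
  · simp [cblockA, litSym, litSymBar, extra, h]

theorem count_cblockA_none {m n : ℕ} (C : Fin n → Clause m) (j : Fin n) :
    (cblockA C j).count none = 0 := by
  simp [cblockA, litSym, litSymBar, extra]

theorem count_strA_inl {m n : ℕ} {C : Fin n → Clause m} (hC : ThreeDistinct C)
    (u : Fin m) (i : Fin n) (b : Bool) :
    (strA C).count (some (.inl (u, i, b))) = if OccursIn C u i then 2 else 0 := by
  simp only [count_strA, count_vblockA_inl, count_cblockA_inl hC, Finset.sum_ite_eq',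
    Finset.mem_univ, if_true]
  split_ifs <;> simp

theorem count_strA_inr {m n : ℕ} (C : Fin n → Clause m) (e : Fin n × Fin 3) :
    (strA C).count (some (.inr e)) = 2 := by
  obtain ⟨i, k⟩ := e
  simp [count_strA, count_vblockA_inr, count_cblockA_inr]

theorem count_strA_none {m n : ℕ} (C : Fin n → Clause m) : (strA C).count none = 1 := by
  simp [count_strA, count_vblockA_none, count_cblockA_none]

/-- In the modified reduction of Corollary 1, each of the two
constructed strings contains every symbol of `Σ` exactly twice, except for the boundary
symbol `•`, which each string contains exactly once. In particular every symbol occurs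
at most twice in each of `a` and `b`. -/
theorem modified_every_symbol_exactly_twice (m n : ℕ) (C : Fin n → Clause m)
    (hC : ThreeDistinct C) :
    (∀ s : Symb m n, InSigma C s → s ≠ none →
      (strA C).count s = 2 ∧ (strB C).count s = 2) ∧
    ((strA C).count none = 1 ∧ (strB C).count none = 1) ∧
    (∀ s : Symb m n, (strA C).count s ≤ 2 ∧ (strB C).count s ≤ 2) := by
  simp only [(strB_perm_strA C).count_eq, and_self]
  refine ⟨?_, count_strA_none C, ?_⟩
  · rintro (_ | ⟨u, i, b⟩ | e) hs hne
    · exact absurd rfl hne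
    · rw [count_strA_inl hC]
      exact if_pos hs
    · exact count_strA_inr C e
  · rintro (_ | ⟨u, i, b⟩ | e)
    · simp [count_strA_none]
    · rw [count_strA_inl hC]
      split_ifs <;> simp
    · exact (count_strA_inr C e).le

end CommonPerm
end
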